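/- Let G = (V₀ ⊎ V₁, E, p) be a parity game, let i ∈ {0,1}, let V_D ⊆ V₁, let R = reach_{¬i}(V₁ \ V_D) and V' = V \ R. Then (a) every i-dominion D of G with D ∩ V₁ ⊆ V_D satisfies D ⊆ V'; and (b) if V' ≠ ∅ then the sub-game G − R is well-defined and win_i(G − R) is an i-dominion of G that contains every i-dominion D of G with D ∩ V₁ ⊆ V_D. -/

import Mathlib

universe u

/-- A parity game on an ambient vertex type `V`: a finite set of nodes, an owner
(player `0` or `1`) for each node, a directed edge relation between nodes, and a
priority function. -/
structure ParityGame (V : Type u) where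
  nodes : Set V
  finite : nodes.Finite
  owner : V → Fin 2
  edge : V → V → Prop
  edge_mem : ∀ u v, edge u v → u ∈ nodes ∧ v ∈ nodes
  priority : V → ℕ

namespace ParityGame

variable {V : Type u}

/-- Every node has at least one outgoing edge. -/
def Proper (G : ParityGame V) : Prop := ∀ u ∈ G.nodes, ∃ v, G.edge u v

/-- The game is bipartite: every edge goes between nodes of the two different players. -/
def Bipartite (G : ParityGame V) : Prop := ∀ u v, G.edge u v → G.owner u ≠ G.owner v

/-- The opponent `¬i = 1 - i` of player `i`. -/
def other (i : Fin 2) : Fin 2 := 1 - i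

/-- The set `V_i` of nodes owned by player `i`. -/
def playerNodes (G : ParityGame V) (i : Fin 2) : Set V := {v | v ∈ G.nodes ∧ G.owner v = i}

/-- An infinite play: consecutive positions are joined by edges. -/
def IsPlay (G : ParityGame V) (f : ℕ → V) : Prop := ∀ n, G.edge (f n) (f (n + 1))

/-- A (history-dependent) strategy: given the history of previously visited nodes and
the current node, it returns the next node. -/
def Strategy (V : Type u) := List V → V → V

/-- A strategy for player `i` is valid if at every node owned by player `i` it chooses
an outgoing edge. -/
def ValidStrategy (G : ParityGame V) (i : Fin 2) (σ : Strategy V) : Prop :=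
  ∀ (h : List V) (u : V), u ∈ G.nodes → G.owner u = i → G.edge u (σ h u)

/-- The play `f` is consistent with the strategy `σ` of player `i`. -/
def Consistent (G : ParityGame V) (i : Fin 2) (σ : Strategy V) (f : ℕ → V) : Prop :=
  ∀ n, G.owner (f n) = i → f (n + 1) = σ (List.ofFn fun k : Fin n => f k.1) (f n)

/-- `P` holds infinitely often. -/
def InfOften (P : ℕ → Prop) : Prop := ∀ N, ∃ n, N ≤ n ∧ P n

/-- Player `i` wins the play `f` if the largest priority occurring infinitely often
on `f` has parity `i`. -/
def WinsPlay (G : ParityGame V) (i : Fin 2) (f : ℕ → V) : Prop :=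
  ∃ q, InfOften (fun n => G.priority (f n) = q) ∧
    (∀ q', InfOften (fun n => G.priority (f n) = q') → q' ≤ q) ∧ q % 2 = i.1

/-- Player `i` has a winning strategy from node `v`. -/
def WinsFrom (G : ParityGame V) (i : Fin 2) (v : V) : Prop :=
  ∃ σ : Strategy V, ValidStrategy G i σ ∧
    ∀ f : ℕ → V, f 0 = v → IsPlay G f → Consistent G i σ f → WinsPlay G i f

/-- The winning set of player `i`. -/
def winSet (G : ParityGame V) (i : Fin 2) : Set V := {v | v ∈ G.nodes ∧ WinsFrom G i v}

/-- A set `B` of nodes is `i`-closed: player `i` can stay inside `B` and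
player `¬i` cannot leave `B`. -/
def IClosed (G : ParityGame V) (i : Fin 2) (B : Set V) : Prop :=
  B ⊆ G.nodes ∧ ∀ u ∈ B,
    (G.owner u = i → ∃ w, G.edge u w ∧ w ∈ B) ∧
    (G.owner u = other i → ∀ w, G.edge u w → w ∈ B)

/-- The `i`-reachability set of `A`: the set `A` together with all nodes from which
player `i` has a strategy guaranteeing that the play enters `A` at least once. -/
def reach (G : ParityGame V) (i : Fin 2) (A : Set V) : Set V :=
  A ∪ {v | v ∈ G.nodes ∧ ∃ σ : Strategy V, ValidStrategy G i σ ∧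
        ∀ f : ℕ → V, f 0 = v → IsPlay G f → Consistent G i σ f → ∃ n, f n ∈ A}

/-- An `i`-dominion: a set of nodes from each of which player `i` can win
without the play ever leaving the set. -/
def IsDominion (G : ParityGame V) (i : Fin 2) (D : Set V) : Prop :=
  D ⊆ G.nodes ∧ ∃ σ : Strategy V, ValidStrategy G i σ ∧
    ∀ v ∈ D, ∀ f : ℕ → V, f 0 = v → IsPlay G f → Consistent G i σ f →
      WinsPlay G i f ∧ ∀ n, f n ∈ D

/-- The sub-game `G − B` obtained by removing the nodes of `B`. -/
def sub (G : ParityGame V) (B : Set V) : ParityGame V where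
  nodes := G.nodes \ B
  finite := G.finite.subset Set.diff_subset
  owner := G.owner
  edge u v := G.edge u v ∧ u ∉ B ∧ v ∉ B
  edge_mem := fun u v h =>
    ⟨⟨(G.edge_mem u v h.1).1, h.2.1⟩, ⟨(G.edge_mem u v h.1).2, h.2.2⟩⟩
  priority := G.priority

/-- The signed priority `p₁`: `p(v)` if `p(v)` is odd, `−p(v)` if `p(v)` is even. -/
def p1 (G : ParityGame V) (v : V) : ℤ :=
  if G.priority v % 2 = 1 then (G.priority v : ℤ) else -(G.priority v : ℤ)

end ParityGame

namespace ParityGame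

variable {V : Type u}

lemma owner_eq_or (i j : Fin 2) : j = i ∨ j = other i := by
  revert i j; decide

lemma other_ne (i : Fin 2) : other i ≠ i := by
  revert i; decide

/-- The list of the first `n` positions of `f`. -/
def hist (f : ℕ → V) (n : ℕ) : List V := (List.range n).map f

lemma ofFn_eq_hist (f : ℕ → V) (n : ℕ) : (List.ofFn fun k : Fin n => f k.1) = hist f n := by
  apply List.ext_getElem <;> simp [hist]

lemma consistent_iff {G : ParityGame V} {i : Fin 2} {σ : Strategy V} {f : ℕ → V} :
    G.Consistent i σ f ↔ ∀ n, G.owner (f n) = i → f (n + 1) = σ (hist f n) (f n) := by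
  simp only [Consistent, ofFn_eq_hist]

lemma hist_succ (f : ℕ → V) (n : ℕ) : hist f (n + 1) = hist f n ++ [f n] := by
  simp [hist, List.range_succ]

lemma hist_succ_eq_cons (f : ℕ → V) (n : ℕ) :
    hist f (n + 1) = f 0 :: hist (fun k => f (k + 1)) n := by
  simp [hist, List.range_succ_eq_map, Function.comp_def]

lemma hist_add (f : ℕ → V) (n m : ℕ) :
    hist f (n + m) = hist f n ++ hist (fun k => f (n + k)) m := by
  simp [hist, List.range_add, Function.comp_def]

lemma hist_congr {f g : ℕ → V} {n : ℕ} (h : ∀ k < n, f k = g k) : hist f n = hist g n := by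
  simpa [hist] using h

lemma length_hist (f : ℕ → V) (n : ℕ) : (hist f n).length = n := by
  simp [hist]

/-- The first node of a nonempty path, given as a history and a current node. -/
def firstNode : List V → V → V
  | [], u => u
  | a :: _, _ => a

lemma firstNode_hist (f : ℕ → V) (n : ℕ) : firstNode (hist f n) (f n) = f 0 := by
  cases n with
  | zero => rfl
  | succ n => rw [hist_succ_eq_cons]; rfl

lemma IsPlay.mem_nodes {G : ParityGame V} {f : ℕ → V} (hf : G.IsPlay f) (n : ℕ) :
    f n ∈ G.nodes := (G.edge_mem _ _ (hf n)).1

lemma Proper.exists_valid {G : ParityGame V} (hG : G.Proper) :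
    ∃ next : V → V, ∀ u ∈ G.nodes, G.edge u (next u) := by
  classical
  choose! next h using hG
  exact ⟨next, h⟩

lemma infOften_add_iff (P : ℕ → Prop) (k : ℕ) :
    InfOften (fun n => P (k + n)) ↔ InfOften P := by
  constructor
  · intro h N
    obtain ⟨n, hn, hP⟩ := h N
    exact ⟨k + n, by omega, hP⟩
  · intro h N
    obtain ⟨n, hn, hP⟩ := h (k + N)
    exact ⟨n - k, by omega, by simpa [Nat.add_sub_cancel' (show k ≤ n by omega)] using hP⟩

lemma winsPlay_add_iff {G : ParityGame V} {i : Fin 2} (f : ℕ → V) (k : ℕ) :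
    G.WinsPlay i (fun n => f (k + n)) ↔ G.WinsPlay i f := by
  have h : ∀ q, InfOften (fun n => G.priority (f (k + n)) = q) ↔
      InfOften (fun n => G.priority (f n) = q) := fun q =>
    infOften_add_iff (fun n => G.priority (f n) = q) k
  simp only [WinsPlay, h]

/-- Valid strategies of the two players determine a common consistent play. -/
lemma exists_play {G : ParityGame V} {i : Fin 2} {σ τ : Strategy V}
    (hσ : G.ValidStrategy i σ) (hτ : G.ValidStrategy (other i) τ) {v : V} (hv : v ∈ G.nodes) :
    ∃ f : ℕ → V, f 0 = v ∧ G.IsPlay f ∧ G.Consistent i σ f ∧ G.Consistent (other i) τ f := by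
  classical
  let next : List V → V → V := fun h u => if G.owner u = i then σ h u else τ h u
  let s : ℕ → List V × V :=
    fun n => Nat.rec ([], v) (fun _ p => (p.1 ++ [p.2], next p.1 p.2)) n
  let f : ℕ → V := fun n => (s n).2
  have hs : ∀ n, (s n).1 = hist f n := by
    intro n
    induction n with
    | zero => rfl
    | succ n ih => rw [hist_succ, ← ih]
  have hf : ∀ n, f (n + 1) = next (hist f n) (f n) := by
    intro n; rw [← hs]
  have hnext : ∀ h u, u ∈ G.nodes → G.edge u (next h u) := by
    intro h u hu
    by_cases ho : G.owner u = i
    · simpa [next, ho] using hσ h u hu ho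
    · simpa [next, ho] using hτ h u hu ((owner_eq_or i _).resolve_left ho)
  have hmem : ∀ n, f n ∈ G.nodes := by
    intro n
    induction n with
    | zero => exact hv
    | succ n ih => rw [hf]; exact (G.edge_mem _ _ (hnext _ _ ih)).2
  refine ⟨f, rfl, fun n => ?_, consistent_iff.2 fun n ho => ?_, consistent_iff.2 fun n ho => ?_⟩
  · rw [hf]; exact hnext _ _ (hmem n)
  · rw [hf]; simp [next, ho]
  · rw [hf]; simp [next, ho, other_ne]

/-- A node belongs to the reachability set as soon as player `j` can make sure that the next
node does. -/
lemma mem_reach_of_step {G : ParityGame V} (hG : G.Proper) {j : Fin 2} {A : Set V} {u : V}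
    (hu : u ∈ G.nodes) (hj : G.owner u = j → ∃ w ∈ G.reach j A, G.edge u w)
    (hj' : G.owner u ≠ j → ∀ w, G.edge u w → w ∈ G.reach j A) : u ∈ G.reach j A := by
  classical
  obtain ⟨next, hnext⟩ := hG.exists_valid
  have hS : ∀ w, ∃ σ : Strategy V, G.ValidStrategy j σ ∧ (w ∈ G.reach j A →
      ∀ f : ℕ → V, f 0 = w → G.IsPlay f → G.Consistent j σ f → ∃ n, f n ∈ A) := by
    intro w
    by_cases hw : w ∈ G.nodes ∧ ∃ σ : Strategy V, G.ValidStrategy j σ ∧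
        ∀ f : ℕ → V, f 0 = w → G.IsPlay f → G.Consistent j σ f → ∃ n, f n ∈ A
    · obtain ⟨-, σ, hσ, h⟩ := hw
      exact ⟨σ, hσ, fun _ => h⟩
    · refine ⟨fun _ x => next x, fun _ x hx _ => hnext x hx, fun hw' f hf _ _ => ⟨0, ?_⟩⟩
      rw [hf]
      exact hw'.resolve_right hw
  choose S hSv hS using hS
  obtain ⟨x, hx, hxR⟩ : ∃ x, G.edge u x ∧ (G.owner u = j → x ∈ G.reach j A) := by
    by_cases ho : G.owner u = j
    · obtain ⟨w, hw, he⟩ := hj ho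
      exact ⟨w, he, fun _ => hw⟩
    · exact ⟨next u, hnext u hu, fun h => absurd h ho⟩
  let τ : Strategy V := fun h y => match h with
    | [] => if y = u then x else next y
    | _ :: t => S (firstNode t y) t y
  refine Or.inr ⟨hu, τ, ?_, ?_⟩
  · rintro (_ | ⟨a, t⟩) y hy ho
    · by_cases hyu : y = u
      · simpa [τ, hyu] using hx
      · simpa [τ, hyu] using hnext y hy
    · exact hSv _ t y hy ho
  · intro f hf0 hf hc
    rw [consistent_iff] at hc
    have hf1 : f 1 ∈ G.reach j A := by
      by_cases ho : G.owner u = j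
      · have h := hc 0 (by rw [hf0, ho])
        have hx1 : f 1 = x := by simpa [τ, hist, hf0] using h
        rw [hx1]
        exact hxR ho
      · exact hj' ho _ (hf0 ▸ hf 0)
    obtain ⟨n, hn⟩ := hS (f 1) hf1 (fun k => f (k + 1)) rfl (fun n => hf (n + 1))
      (consistent_iff.2 fun n ho => by
        have h := hc (n + 1) ho
        rw [hist_succ_eq_cons] at h
        have h' := firstNode_hist (fun k => f (k + 1)) n
        simp only [τ] at h
        simp only [zero_add] at h'
        rwa [h'] at h)
    exact ⟨n + 1, hn⟩

/-- A dominion of player `i` avoiding `A` is disjoint from the `¬i`-reachability set of `A`. -/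
lemma IsDominion.disjoint_reach {G : ParityGame V} {i : Fin 2} {D A : Set V}
    (hD : G.IsDominion i D) (hDA : Disjoint D A) : Disjoint D (G.reach (other i) A) := by
  rw [Set.disjoint_left] at hDA ⊢
  obtain ⟨hDn, σ, hσ, h⟩ := hD
  rintro v hv (hvA | ⟨hvn, τ, hτ, hτA⟩)
  · exact hDA hv hvA
  · obtain ⟨f, hf0, hf, hfσ, hfτ⟩ := exists_play hσ hτ hvn
    obtain ⟨n, hn⟩ := hτA f hf0 hf hfτ
    exact hDA ((h v hv f hf0 hf hfσ).2 n) hn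

/-- Player `¬i` cannot move into `B` from outside `B`. -/
def Escapeless (G : ParityGame V) (i : Fin 2) (B : Set V) : Prop :=
  ∀ u ∈ G.nodes \ B, G.owner u ≠ i → ∀ w, G.edge u w → w ∉ B

lemma escapeless_reach {G : ParityGame V} (hG : G.Proper) (i : Fin 2) (A : Set V) :
    G.Escapeless i (G.reach (other i) A) := fun _ hu ho w he hw =>
  hu.2 (mem_reach_of_step hG hu.1 (fun _ => ⟨w, hw, he⟩)
    fun ho' => absurd ((owner_eq_or i _).resolve_left ho) ho')

lemma sub_reach_proper {G : ParityGame V} (hG : G.Proper) (i : Fin 2) (A : Set V) :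
    (G.sub (G.reach i A)).Proper := by
  rintro u ⟨hu, huR⟩
  by_contra hcon
  refine huR (mem_reach_of_step hG hu (fun _ => ?_) fun _ w he => ?_)
  · obtain ⟨w, he⟩ := hG u hu
    by_contra hw
    exact hcon ⟨w, he, huR, fun h => hw ⟨w, h, he⟩⟩
  · by_contra hw
    exact hcon ⟨w, he, huR, hw⟩

/-- Every position of a play consistent with a winning strategy is winning. -/
lemma winsFrom_of_consistent {G : ParityGame V} {i : Fin 2} {σ : Strategy V}
    (hσ : G.ValidStrategy i σ) {v : V}
    (hw : ∀ f : ℕ → V, f 0 = v → G.IsPlay f → G.Consistent i σ f → G.WinsPlay i f)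
    {f : ℕ → V} (hf0 : f 0 = v) (hf : G.IsPlay f) (hc : G.Consistent i σ f) (n : ℕ) :
    G.WinsFrom i (f n) := by
  refine ⟨fun h u => σ (hist f n ++ h) u, fun h u => hσ _ u, fun g hg0 hg hgc => ?_⟩
  replace hc := consistent_iff.1 hc
  replace hgc := consistent_iff.1 hgc
  let F : ℕ → V := fun m => if m < n then f m else g (m - n)
  have hlt : ∀ m ≤ n, F m = f m := by
    intro m hm
    rcases hm.lt_or_eq with hm | rfl
    · simp [F, hm]
    · simp [F, hg0]
  have hge : ∀ m, F (n + m) = g m := by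
    intro m; simp [F]
  have hhist : ∀ m, hist F (n + m) = hist f n ++ hist g m := by
    intro m
    rw [hist_add, hist_congr fun k hk => hlt k hk.le, hist_congr fun k _ => hge k]
  have hF := hw F (by rw [hlt 0 n.zero_le, hf0]) ?_ (consistent_iff.2 ?_)
  · rw [← winsPlay_add_iff F n] at hF
    simpa only [hge] using hF
  · intro m
    rcases lt_or_ge m n with hm | hm
    · rw [hlt m hm.le, hlt (m + 1) hm]
      exact hf m
    · obtain ⟨k, rfl⟩ := Nat.exists_eq_add_of_le hm
      rw [add_assoc, hge, hge]
      exact hg k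
  · intro m ho
    rcases lt_or_ge m n with hm | hm
    · rw [hlt m hm.le] at ho ⊢
      rw [hlt (m + 1) hm, hist_congr fun k hk => hlt k (hk.trans hm).le]
      exact hc m ho
    · obtain ⟨k, rfl⟩ := Nat.exists_eq_add_of_le hm
      rw [hge] at ho
      rw [hhist, add_assoc, hge, hge]
      exact hgc k ho

/-- If player `¬i` cannot move into `B`, then the winning set of player `i` in `G − B` is an
`i`-dominion of `G`. -/
lemma isDominion_winSet_sub {G : ParityGame V} (hG : G.Proper) {i : Fin 2} {B : Set V}
    (hB : G.Escapeless i B) : G.IsDominion i ((G.sub B).winSet i) := by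
  classical
  obtain ⟨next, hnext⟩ := hG.exists_valid
  refine ⟨fun v hv => hv.1.1, ?_⟩
  have hS : ∀ v, ∃ σ : Strategy V, v ∈ (G.sub B).winSet i → (G.sub B).ValidStrategy i σ ∧
      ∀ f : ℕ → V, f 0 = v → (G.sub B).IsPlay f → (G.sub B).Consistent i σ f →
        (G.sub B).WinsPlay i f := by
    intro v
    by_cases hv : v ∈ (G.sub B).winSet i
    · obtain ⟨σ, h⟩ := hv.2
      exact ⟨σ, fun _ => h⟩
    · exact ⟨fun _ => next, fun h => absurd h hv⟩
  choose S hS using hS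
  let σ : Strategy V := fun h u =>
    if firstNode h u ∈ (G.sub B).winSet i ∧ u ∉ B then S (firstNode h u) h u else next u
  refine ⟨σ, fun h u hu ho => ?_, fun v hv f hf0 hf hc => ?_⟩
  · by_cases hc : firstNode h u ∈ (G.sub B).winSet i ∧ u ∉ B
    · simp only [σ, if_pos hc]
      exact ((hS _ hc.1).1 h u ⟨hu, hc.2⟩ ho).1
    · simp only [σ, if_neg hc]
      exact hnext u hu
  · obtain ⟨hSv, hSw⟩ := hS v hv
    rw [consistent_iff] at hc
    have hσ : ∀ n, f n ∉ B → σ (hist f n) (f n) = S v (hist f n) (f n) := by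
      intro n hn
      simp only [σ, firstNode_hist, hf0]
      rw [if_pos ⟨hv, hn⟩]
    have hfB : ∀ n, f n ∉ B := by
      intro n
      induction n with
      | zero => rw [hf0]; exact hv.1.2
      | succ n ih =>
        by_cases ho : G.owner (f n) = i
        · rw [hc n ho, hσ n ih]
          exact (hSv _ _ ⟨hf.mem_nodes n, ih⟩ ho).2.2
        · exact hB _ ⟨hf.mem_nodes n, ih⟩ ho _ (hf n)
    have hf' : (G.sub B).IsPlay f := fun n => ⟨hf n, hfB n, hfB (n + 1)⟩
    have hc' : (G.sub B).Consistent i (S v) f :=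
      consistent_iff.2 fun n ho => (hc n ho).trans (hσ n (hfB n))
    exact ⟨hSw f hf0 hf' hc', fun n =>
      ⟨hf'.mem_nodes n, winsFrom_of_consistent hSv hSw hf0 hf' hc' n⟩⟩

/-- An `i`-dominion disjoint from `B` is won by player `i` in `G − B`. -/
lemma IsDominion.subset_winSet_sub {G : ParityGame V} (hG : G.Proper) {i : Fin 2} {B D : Set V}
    (hB : (G.sub B).Proper) (hD : G.IsDominion i D) (hDB : Disjoint D B) :
    D ⊆ (G.sub B).winSet i := by
  classical
  rw [Set.disjoint_left] at hDB
  obtain ⟨next, hnext⟩ := hG.exists_valid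
  obtain ⟨next', hnext'⟩ := hB.exists_valid
  obtain ⟨hDn, σ, hσ, hw⟩ := hD
  intro v hv
  refine ⟨⟨hDn hv, hDB hv⟩,
    fun h u => if (G.sub B).edge u (σ h u) then σ h u else next' u, fun h u hu ho => ?_,
    fun f hf0 hf hc => ?_⟩
  · dsimp only
    split_ifs with he
    · exact he
    · exact hnext' u hu
  · let τ : Strategy V := fun h u =>
      if G.edge u (f (h.length + 1)) then f (h.length + 1) else next u
    have hτ : G.ValidStrategy (other i) τ := by
      intro h u hu _
      simp only [τ]
      split_ifs with he
      · exact he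
      · exact hnext u hu
    obtain ⟨g, hg0, hg, hgσ, hgτ⟩ := exists_play hσ hτ (hDn hv)
    obtain ⟨hgw, hgD⟩ := hw v hv g hg0 hg hgσ
    rw [consistent_iff] at hgσ hgτ
    replace hc := consistent_iff.1 hc
    have hfg : ∀ n, ∀ k ≤ n, f k = g k := by
      intro n
      induction n with
      | zero => intro k hk; rw [Nat.le_zero.1 hk, hf0, hg0]
      | succ n ih =>
        intro k hk
        rcases hk.lt_or_eq with hk | rfl
        · exact ih k (by omega)
        have hh : hist f n = hist g n := hist_congr fun k hk => ih k hk.le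
        have hn := ih n le_rfl
        rcases owner_eq_or i (G.owner (g n)) with ho | ho
        · have h1 := hc n (by rw [hn]; exact ho)
          have h2 := hgσ n ho
          rw [hh, hn, ← h2, if_pos ⟨hg n, hDB (hgD n), hDB (hgD (n + 1))⟩] at h1
          exact h1
        · have h2 := hgτ n ho
          have he : G.edge (g n) (f (n + 1)) := hn ▸ (hf n).1
          simp only [τ, length_hist, if_pos he] at h2
          exact h2.symm
    obtain rfl : f = g := funext fun n => hfg n n le_rfl
    exact hgw

end ParityGame

/-- Let `V_D ⊆ V₁`, `R = reach_{¬i}(V₁ \ V_D)` and `V' = V \ R`.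
(a) Every `i`-dominion `D` with `D ∩ V₁ ⊆ V_D` satisfies `D ⊆ V'`; and (b) if
`V' ≠ ∅` then the sub-game `G − R` is well-defined and `win_i(G − R)` is an
`i`-dominion of `G` containing every `i`-dominion `D` with `D ∩ V₁ ⊆ V_D`. -/
theorem dominion_search {V : Type} (G : ParityGame V) (hG : G.Proper) (i : Fin 2)
    (VD : Set V) (hVD : VD ⊆ G.playerNodes 1)
    (R V' : Set V)
    (hR : R = G.reach (ParityGame.other i) (G.playerNodes 1 \ VD))
    (hV' : V' = G.nodes \ R) :
    (∀ D, G.IsDominion i D → D ∩ G.playerNodes 1 ⊆ VD → D ⊆ V') ∧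
      (V'.Nonempty →
        (G.sub R).Proper ∧
        G.IsDominion i ((G.sub R).winSet i) ∧
        ∀ D, G.IsDominion i D → D ∩ G.playerNodes 1 ⊆ VD →
          D ⊆ (G.sub R).winSet i) := by
  subst hR hV'
  have hdisj : ∀ D, G.IsDominion i D → D ∩ G.playerNodes 1 ⊆ VD →
      Disjoint D (G.reach (ParityGame.other i) (G.playerNodes 1 \ VD)) := fun D hD hDV =>
    hD.disjoint_reach (Set.disjoint_left.2 fun v hv hv' => hv'.2 (hDV ⟨hv, hv'.1⟩))
  have hsub := ParityGame.sub_reach_proper hG (ParityGame.other i) (G.playerNodes 1 \ VD)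
  refine ⟨fun D hD hDV v hv => ⟨hD.1 hv, Set.disjoint_left.1 (hdisj D hD hDV) hv⟩,
    fun _ => ⟨hsub, ?_, fun D hD hDV => hD.subset_winSet_sub hG hsub (hdisj D hD hDV)⟩⟩
  exact ParityGame.isDominion_winSet_sub hG (ParityGame.escapeless_reach hG i _)
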